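/- Let ξ > 2 and let φ ∈ (0, π/4) satisfy 1 − √(1 − 2/ξ) < √(2(cos 2φ + 1)) < 1 + √(1 − 2/ξ). Set C'(φ) = 1/( 1 + cos 2φ − √(2(1 + cos 2φ)) ). Then for every k = u + iv with v ≥ 0 and v ≤ |u|·tan φ (i.e. k ∈ Υ₁ ∪ Υ₂), one has Im θ_ξ(k) ≥ (Im k)·( ξ + C'(φ) ); and for every k = u + iv with v ≤ 0 and |v| ≤ |u|·tan φ (i.e. k ∈ Υ₃ ∪ Υ₄), one has Im θ_ξ(k) ≤ (Im k)·( ξ + C'(φ) ). -/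

import Mathlib

/-- The phase function of the Camassa–Holm Riemann–Hilbert problem:
`θ_ξ(k) = kξ − k/(2k² + 1/2)`. -/
noncomputable def thetaCH (ξ : ℝ) (k : ℂ) : ℂ :=
  k * (ξ : ℂ) - k / (2 * k ^ 2 + 1 / 2)

theorem thetaCH_im (ξ u v : ℝ) :
    (thetaCH ξ (u + v * Complex.I)).im =
      v * (ξ + (2 * (u ^ 2 + v ^ 2) - 1 / 2) /
        ((2 * (u ^ 2 - v ^ 2) + 1 / 2) ^ 2 + (4 * u * v) ^ 2)) := by
  have hden : 2 * ((u : ℂ) + v * Complex.I) ^ 2 + 1 / 2 =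
      ⟨2 * (u ^ 2 - v ^ 2) + 1 / 2, 4 * u * v⟩ := by
    apply Complex.ext
    · simp [pow_two]
    · simp [pow_two]
      ring
  unfold thetaCH
  rw [hden]
  simp only [Complex.sub_im, Complex.div_im, Complex.mul_im, Complex.add_im, Complex.add_re,
    Complex.mul_re, Complex.ofReal_re, Complex.ofReal_im, Complex.I_re, Complex.I_im,
    Complex.normSq_mk]
  ring

/-- In polar form: if the argument `ω` of `k = u + iv` satisfies `|tan ω| ≤ tan φ`, then
`|k|² cos 2φ ≤ |k|² cos 2ω`. -/
theorem cos_two_mul_mul_le_of_abs_le {φ u v : ℝ} (hφ : 0 < Real.cos φ)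
    (h : |v| ≤ |u| * Real.tan φ) :
    Real.cos (2 * φ) * (u ^ 2 + v ^ 2) ≤ u ^ 2 - v ^ 2 := by
  have h1 : |v| * Real.cos φ ≤ |u| * Real.sin φ := by
    rw [Real.tan_eq_sin_div_cos, ← mul_div_assoc, le_div_iff₀ hφ] at h
    exact h
  have h2 : (|v| * Real.cos φ) ^ 2 ≤ (|u| * Real.sin φ) ^ 2 :=
    pow_le_pow_left₀ (by positivity) h1 2
  rw [mul_pow, mul_pow, sq_abs, sq_abs, Real.sin_sq] at h2
  rw [Real.cos_two_mul]
  linarith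

theorem inv_le_div_of_cos_mul_le {c u v : ℝ} (hc0 : 0 < c) (hc1 : c < 1)
    (h : c * (u ^ 2 + v ^ 2) ≤ u ^ 2 - v ^ 2) :
    1 / (1 + c - √(2 * (1 + c))) ≤ (2 * (u ^ 2 + v ^ 2) - 1 / 2) /
      ((2 * (u ^ 2 - v ^ 2) + 1 / 2) ^ 2 + (4 * u * v) ^ 2) := by
  set s := √(2 * (1 + c)) with hs
  have hs2 : s ^ 2 = 2 * (1 + c) := Real.sq_sqrt (by linarith)
  have hneg : 1 + c - s < 0 := by
    have : 1 + c < s := Real.lt_sqrt_of_sq_lt (by nlinarith)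
    linarith
  have hpos : 0 < (2 * (u ^ 2 - v ^ 2) + 1 / 2) ^ 2 + (4 * u * v) ^ 2 := by
    have : 0 ≤ c * (u ^ 2 + v ^ 2) := by positivity
    have : 0 < 2 * (u ^ 2 - v ^ 2) + 1 / 2 := by linarith
    positivity
  rw [le_div_iff₀ hpos, div_mul_eq_mul_div, one_mul, div_le_iff_of_neg hneg]
  have hsq := sq_nonneg (4 * (u ^ 2 + v ^ 2) - 1 + s)
  linear_combination hsq / 4 + 2 * h + hs2 / 4

/-- For `ξ > 2` and `φ ∈ (0, π/4)` with
`1 − √(1 − 2/ξ) < √(2(cos 2φ + 1)) < 1 + √(1 − 2/ξ)`, setting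
`C'(φ) = 1/(1 + cos 2φ − √(2(1 + cos 2φ)))`, one has
`Im θ_ξ(k) ≥ (Im k)·(ξ + C'(φ))` on the sectors `Υ₁ ∪ Υ₂` (`v ≥ 0`, `v ≤ |u| tan φ`)
and `Im θ_ξ(k) ≤ (Im k)·(ξ + C'(φ))` on the sectors `Υ₃ ∪ Υ₄` (`v ≤ 0`, `|v| ≤ |u| tan φ`). -/
theorem stmt_3 (ξ φ : ℝ) (hξ : 2 < ξ) (hφ : φ ∈ Set.Ioo 0 (Real.pi / 4))
    (hcond₁ : 1 - Real.sqrt (1 - 2 / ξ) < Real.sqrt (2 * (Real.cos (2 * φ) + 1)))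
    (hcond₂ : Real.sqrt (2 * (Real.cos (2 * φ) + 1)) < 1 + Real.sqrt (1 - 2 / ξ)) :
    (∀ u v : ℝ, 0 ≤ v → v ≤ |u| * Real.tan φ →
      (thetaCH ξ (u + v * Complex.I)).im ≥
        v * (ξ + 1 / (1 + Real.cos (2 * φ) - Real.sqrt (2 * (1 + Real.cos (2 * φ)))))) ∧
    (∀ u v : ℝ, v ≤ 0 → |v| ≤ |u| * Real.tan φ →
      (thetaCH ξ (u + v * Complex.I)).im ≤
        v * (ξ + 1 / (1 + Real.cos (2 * φ) - Real.sqrt (2 * (1 + Real.cos (2 * φ)))))) := by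
  have hc0 : 0 < Real.cos (2 * φ) :=
    Real.cos_pos_of_mem_Ioo ⟨by linarith [hφ.1, Real.pi_pos], by linarith [hφ.2]⟩
  have hc1 : Real.cos (2 * φ) < 1 := by
    have := Real.cos_lt_cos_of_nonneg_of_le_pi le_rfl
      (by linarith [hφ.2, Real.pi_pos] : 2 * φ ≤ Real.pi) (by linarith [hφ.1])
    rwa [Real.cos_zero] at this
  have hcos : 0 < Real.cos φ :=
    Real.cos_pos_of_mem_Ioo ⟨by linarith [hφ.1, Real.pi_pos], by linarith [hφ.2, Real.pi_pos]⟩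
  have key (u v : ℝ) (h : |v| ≤ |u| * Real.tan φ) :=
    add_le_add_right (inv_le_div_of_cos_mul_le hc0 hc1 (cos_two_mul_mul_le_of_abs_le hcos h)) ξ
  refine ⟨fun u v hv h => ?_, fun u v hv h => ?_⟩
  · rw [thetaCH_im]
    exact mul_le_mul_of_nonneg_left (key u v (by rwa [abs_of_nonneg hv])) hv
  · rw [thetaCH_im]
    exact mul_le_mul_of_nonpos_left (key u v h) hv
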